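/- Let (Ω, F, p) be a probability space and M : Ω → M_d(ℂ) a random reduced dynamics operator with fixed invariant unit vector ψ_S, and suppose p({ω : M(ω) ∈ ℳ_(E)}) > 0. Let l, r ≥ 0 and let N : Ω^{l+r+1} → M_d(ℂ) be a bounded measurable map. Then there exists a set Ω_5 ⊆ Ω^{ℕ*} with ℙ(Ω_5) = 1 such that for every ω̄ = (ω_n)_{n≥1} ∈ Ω_5, lim_{ν→∞} (1/ν) Σ_{n=1}^ν M(ω_1) ⋯ M(ω_n) N(ω_{n+1}, …, ω_{n+l+r+1}) = |ψ_S⟩⟨θ| · E[N], where θ := P_{1,E[M]}^* ψ_S, P_{1,E[M]} is the spectral projection of E[M] for the eigenvalue 1, and E[N] := ∫_{Ω^{l+r+1}} N d(p^{⊗(l+r+1)}). -/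

import Mathlib

open scoped BigOperators
open MeasureTheory Filter ContinuousLinearMap

noncomputable section

abbrev Evec (d : ℕ) := EuclideanSpace ℂ (Fin d)
abbrev Op (d : ℕ) := Evec d →L[ℂ] Evec d

/-- `ketBra u v = |u⟩⟨v|`, the rank-one operator `x ↦ ⟪v, x⟫ • u`. -/
def ketBra {d : ℕ} (u v : Evec d) : Op d := (innerSL ℂ v).smulRight u

/-- The spectral projection for the eigenvalue `1`, as the limit of Cesàro averages. -/
def cesaroProj {d : ℕ} (A : Op d) : Op d :=
  limUnder atTop (fun N : ℕ => (N : ℂ)⁻¹ • ∑ k ∈ Finset.range N, A ^ k)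

/-- The class `ℳ_(E)`. -/
def mcalE {d : ℕ} (ψS : Evec d) (A : Op d) : Prop :=
  (∃ Nrm : Seminorm ℂ (Evec d), (∀ x, Nrm x = 0 → x = 0) ∧ ∀ x, Nrm (A x) ≤ Nrm x) ∧
  A ψS = ψS ∧
  spectrum ℂ A ∩ {z : ℂ | ‖z‖ = 1} = {1} ∧
  Module.finrank ℂ (Module.End.maxGenEigenspace (A : Evec d →ₗ[ℂ] Evec d) 1) = 1

/-- `ψ(ω) = P₁(ω)* ψ_S`. -/
def psiOf {d : ℕ} (ψS : Evec d) (A : Op d) : Evec d := adjoint (cesaroProj A) ψS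

/-- `Q(ω) = 1 - |ψ_S⟩⟨ψ(ω)|`. -/
def Qof {d : ℕ} (ψS : Evec d) (A : Op d) : Op d := 1 - ketBra ψS (psiOf ψS A)

/-- `M_Q(ω) = Q(ω) M(ω) Q(ω)`. -/
def MQof {d : ℕ} (ψS : Evec d) (A : Op d) : Op d := Qof ψS A * A * Qof ψS A

open scoped Topology InnerProductSpace
open ProbabilityTheory

section Deterministic

variable {d : ℕ}

lemma Seminorm.exists_le_mul_norm (q : Seminorm ℂ (Evec d)) :
    ∃ C : ℝ, 0 < C ∧ ∀ x, q x ≤ C * ‖x‖ := by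
  refine ⟨∑ i, q (EuclideanSpace.basisFun (Fin d) ℂ i) + 1,
    add_pos_of_nonneg_of_pos (Finset.sum_nonneg fun i _ => apply_nonneg q _) one_pos, fun x => ?_⟩
  conv_lhs => rw [← (EuclideanSpace.basisFun (Fin d) ℂ).sum_repr x]
  calc q (∑ i, (EuclideanSpace.basisFun (Fin d) ℂ).repr x i • EuclideanSpace.basisFun (Fin d) ℂ i)
      ≤ ∑ i, q ((EuclideanSpace.basisFun (Fin d) ℂ).repr x i •
          EuclideanSpace.basisFun (Fin d) ℂ i) :=
        Finset.le_sum_of_subadditive q (map_zero q).le (map_add_le_add q) _ _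
    _ ≤ ∑ i, ‖x‖ * q (EuclideanSpace.basisFun (Fin d) ℂ i) := by
        refine Finset.sum_le_sum fun i _ => ?_
        rw [map_smul_eq_mul]
        refine mul_le_mul_of_nonneg_right ?_ (apply_nonneg q _)
        simpa using PiLp.norm_apply_le x i
    _ ≤ _ := by
        rw [← Finset.mul_sum]
        nlinarith [norm_nonneg x]

lemma Seminorm.continuous_evec (q : Seminorm ℂ (Evec d)) : Continuous q := by
  obtain ⟨C, hC, h⟩ := q.exists_le_mul_norm
  refine Seminorm.continuous_of_continuousAt_zero ?_
  rw [ContinuousAt, map_zero]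
  refine squeeze_zero (fun x => apply_nonneg q x) h ?_
  have : Tendsto (fun x : Evec d => C * ‖x‖) (𝓝 0) (𝓝 (C * ‖(0 : Evec d)‖)) :=
    (continuous_const.mul continuous_norm).tendsto 0
  simpa using this

lemma Seminorm.exists_norm_le_mul (q : Seminorm ℂ (Evec d)) (hq : ∀ x, q x = 0 → x = 0) :
    ∃ C : ℝ, 0 < C ∧ ∀ x, ‖x‖ ≤ C * q x := by
  rcases (Metric.sphere (0 : Evec d) 1).eq_empty_or_nonempty with he | hne
  · refine ⟨1, one_pos, fun x => ?_⟩
    by_cases hx : x = 0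
    · simp [hx]
    · exfalso
      have : (((‖x‖⁻¹ : ℝ) : ℂ) • x) ∈ Metric.sphere (0 : Evec d) 1 := by
        simp [norm_smul, hx]
      simp [he] at this
  · obtain ⟨y, hy, hmin⟩ := (isCompact_sphere (0 : Evec d) 1).exists_isMinOn hne
      q.continuous_evec.continuousOn
    have hy1 : ‖y‖ = 1 := by simpa using hy
    have hqy : 0 < q y := by
      refine lt_of_le_of_ne (apply_nonneg q y) fun h => ?_
      rw [hq y h.symm] at hy1
      simp at hy1
    refine ⟨(q y)⁻¹, inv_pos.2 hqy, fun x => ?_⟩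
    by_cases hx : x = 0
    · simp [hx]
    have hmem : (((‖x‖⁻¹ : ℝ) : ℂ) • x) ∈ Metric.sphere (0 : Evec d) 1 := by
      simp [norm_smul, hx]
    have h : q y ≤ q (((‖x‖⁻¹ : ℝ) : ℂ) • x) := hmin hmem
    have hx0 : 0 < ‖x‖ := norm_pos_iff.2 hx
    rw [map_smul_eq_mul, Complex.norm_real, Real.norm_of_nonneg (by positivity),
      le_inv_mul_iff₀ hx0] at h
    rw [le_inv_mul_iff₀ hqy]
    linarith

/-- Operators contracting a given norm are uniformly bounded. -/
lemma exists_opNorm_bound (q : Seminorm ℂ (Evec d)) (hq : ∀ x, q x = 0 → x = 0) :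
    ∃ K : ℝ, 0 < K ∧ ∀ A : Op d, (∀ x, q (A x) ≤ q x) → ‖A‖ ≤ K := by
  obtain ⟨C, hC, h₁⟩ := q.exists_le_mul_norm
  obtain ⟨C', hC', h₂⟩ := q.exists_norm_le_mul hq
  refine ⟨C' * C, by positivity, fun A hA => A.opNorm_le_bound (by positivity) fun x => ?_⟩
  calc ‖A x‖ ≤ C' * q (A x) := h₂ _
    _ ≤ C' * (C * ‖x‖) := by gcongr; exact (hA x).trans (h₁ x)
    _ = _ := by ring

lemma seminorm_pow_apply_le {q : Seminorm ℂ (Evec d)} {A : Op d} (hA : ∀ x, q (A x) ≤ q x)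
    (n : ℕ) (x : Evec d) : q ((A ^ n) x) ≤ q x := by
  induction n with
  | zero => simp
  | succ n ih => rw [pow_succ']; exact (hA _).trans ih

lemma tendsto_op_apply {T : ℕ → Op d} {S : Op d} (h : Tendsto T atTop (𝓝 S)) (x : Evec d) :
    Tendsto (fun n => T n x) atTop (𝓝 (S x)) :=
  ((ContinuousLinearMap.apply ℂ (Evec d) x).continuous.tendsto S).comp h

/-- Cesàro averages of the powers of `A`. -/
def cesaroAvg (A : Op d) (N : ℕ) : Op d := (N : ℂ)⁻¹ • ∑ k ∈ Finset.range N, A ^ k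

lemma cesaroAvg_apply_of_fixed {A : Op d} {x : Evec d} (hx : A x = x) {N : ℕ} (hN : N ≠ 0) :
    cesaroAvg A N x = x := by
  have h : ∀ k : ℕ, (A ^ k) x = x := fun k => by
    induction k with
    | zero => simp
    | succ k ih => rw [pow_succ']; exact (congrArg A ih).trans hx
  simp [cesaroAvg, h, ← Nat.cast_smul_eq_nsmul ℂ, smul_smul, hN]

lemma cesaroAvg_mul_sub (A : Op d) (N : ℕ) :
    cesaroAvg A N * (1 - A) = (N : ℂ)⁻¹ • (1 - A ^ N) := by
  rw [cesaroAvg, smul_mul_assoc, geom_sum_mul_neg]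

/-- A sequence bounded in norm divided by `n` tends to zero. -/
lemma tendsto_inv_smul_of_bounded {𝕜 E : Type*} [RCLike 𝕜] [NormedAddCommGroup E]
    [NormedSpace 𝕜 E] {u : ℕ → E} {C : ℝ} (hu : ∀ n, ‖u n‖ ≤ C) :
    Tendsto (fun n : ℕ => (n : 𝕜)⁻¹ • u n) atTop (𝓝 0) := by
  rw [tendsto_zero_iff_norm_tendsto_zero]
  refine squeeze_zero (fun n => norm_nonneg _) (g := fun n : ℕ => C / n) (fun n => ?_)
    (tendsto_const_div_atTop_nhds_zero_nat C)
  rw [norm_smul, norm_inv, RCLike.norm_natCast, div_eq_inv_mul]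
  gcongr
  exact hu n

variable {q : Seminorm ℂ (Evec d)} {A : Op d}

lemma tendsto_cesaroAvg_mul_sub (hq : ∀ x, q x = 0 → x = 0) (hA : ∀ x, q (A x) ≤ q x) :
    Tendsto (fun N => cesaroAvg A N * (1 - A)) atTop (𝓝 0) := by
  obtain ⟨K, -, hK⟩ := exists_opNorm_bound q hq
  simp_rw [cesaroAvg_mul_sub]
  refine tendsto_inv_smul_of_bounded (C := ‖(1 : Op d)‖ + K) fun n => ?_
  exact (norm_sub_le _ _).trans (by gcongr; exact hK _ (seminorm_pow_apply_le hA n))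

/-- Decomposition of the space in the mean ergodic theorem. -/
lemma exists_fixed_add_range (hq : ∀ x, q x = 0 → x = 0) (hA : ∀ x, q (A x) ≤ q x)
    (x : Evec d) : ∃ u y : Evec d, A u = u ∧ x = u + (y - A y) := by
  let T : Evec d →ₗ[ℂ] Evec d := (1 - A : Op d)
  have hdisj : Disjoint (LinearMap.ker T) (LinearMap.range T) := by
    rw [Submodule.disjoint_def]
    rintro z hz ⟨y, rfl⟩
    have hfix : A (T y) = T y := by
      have : T y - A (T y) = 0 := hz
      exact (sub_eq_zero.1 this).symm
    have h1 : Tendsto (fun N => (cesaroAvg A N * (1 - A)) y) atTop (𝓝 0) := by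
      simpa using tendsto_op_apply (tendsto_cesaroAvg_mul_sub hq hA) y
    have h2 : Tendsto (fun N => (cesaroAvg A N * (1 - A)) y) atTop (𝓝 (T y)) := by
      refine tendsto_const_nhds.congr' ?_
      filter_upwards [eventually_ne_atTop 0] with N hN
      exact (cesaroAvg_apply_of_fixed hfix hN).symm
    exact tendsto_nhds_unique h2 h1
  have hsup : LinearMap.ker T ⊔ LinearMap.range T = ⊤ :=
    (Submodule.isCompl_iff_disjoint _ _ (by
      rw [add_comm, LinearMap.finrank_range_add_finrank_ker])).2 hdisj |>.sup_eq_top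
  obtain ⟨u, hu, _, ⟨y, rfl⟩, h⟩ := Submodule.mem_sup.1 (hsup ▸ Submodule.mem_top (x := x))
  refine ⟨u, y, ?_, h.symm⟩
  have : u - A u = 0 := hu
  exact (sub_eq_zero.1 this).symm

lemma tendsto_op_of_tendsto_basis {T : ℕ → Op d} {S : Op d}
    (h : ∀ i, Tendsto (fun n => T n (EuclideanSpace.basisFun (Fin d) ℂ i)) atTop
      (𝓝 (S (EuclideanSpace.basisFun (Fin d) ℂ i)))) : Tendsto T atTop (𝓝 S) := by
  have key : ∀ R : Op d, R = ∑ i, (innerSL ℂ (EuclideanSpace.basisFun (Fin d) ℂ i)).smulRight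
      (R (EuclideanSpace.basisFun (Fin d) ℂ i)) := fun R => by
    ext1 x
    conv_lhs => rw [← (EuclideanSpace.basisFun (Fin d) ℂ).sum_repr' x]
    simp
  have h' : Tendsto (fun n => ∑ i, (innerSL ℂ (EuclideanSpace.basisFun (Fin d) ℂ i)).smulRight
      (T n (EuclideanSpace.basisFun (Fin d) ℂ i))) atTop
      (𝓝 (∑ i, (innerSL ℂ (EuclideanSpace.basisFun (Fin d) ℂ i)).smulRight
      (S (EuclideanSpace.basisFun (Fin d) ℂ i)))) := by
    refine tendsto_finsetSum _ fun i _ => ?_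
    exact ((smulRightL ℂ (Evec d) (Evec d)
      (innerSL ℂ (EuclideanSpace.basisFun (Fin d) ℂ i))).continuous.tendsto _).comp (h i)
  rw [key S]
  exact h'.congr fun n => (key (T n)).symm

/-- If `1` is a simple eigenvalue of a contraction with eigenvector `ψ`, its Cesàro averages tend
to a projection onto the line of `ψ`. -/
lemma tendsto_of_simple (hq : ∀ x, q x = 0 → x = 0) (hA : ∀ x, q (A x) ≤ q x) {ψ : Evec d}
    (hψ : ‖ψ‖ = 1) (hAψ : A ψ = ψ) (hsimple : ∀ x, A x = x → ∃ c : ℂ, x = c • ψ)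
    {T : ℕ → Op d} (hTψ : ∀ᶠ n in atTop, T n ψ = ψ)
    (hT : Tendsto (fun n => T n * (1 - A)) atTop (𝓝 0)) :
    Tendsto T atTop (𝓝 (ketBra ψ (adjoint (cesaroProj A) ψ))) := by
  choose u y hu hx using exists_fixed_add_range hq hA
  choose c hc using fun x => hsimple (u x) (hu x)
  have key : ∀ {R : ℕ → Op d}, (∀ᶠ n in atTop, R n ψ = ψ) →
      Tendsto (fun n => R n * (1 - A)) atTop (𝓝 0) →
      ∀ x, Tendsto (fun n => R n x) atTop (𝓝 (c x • ψ)) := by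
    intro R hRψ hR x
    have h0 : Tendsto (fun n => c x • ψ + (R n * (1 - A)) (y x)) atTop (𝓝 (c x • ψ)) := by
      simpa using tendsto_const_nhds.add (tendsto_op_apply hR (y x))
    refine h0.congr' ?_
    filter_upwards [hRψ] with n hn
    conv_rhs => rw [hx x, hc x]
    simp [hn]
  have hces := key (R := cesaroAvg A)
    ((eventually_ne_atTop 0).mono fun n hn => cesaroAvg_apply_of_fixed hAψ hn)
    (tendsto_cesaroAvg_mul_sub hq hA)
  let P : Op d := ∑ i, (innerSL ℂ (EuclideanSpace.basisFun (Fin d) ℂ i)).smulRight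
      (c (EuclideanSpace.basisFun (Fin d) ℂ i) • ψ)
  have hP : ∀ x, P x = c x • ψ := fun x => by
    refine tendsto_nhds_unique ?_ (hces x)
    conv =>
      enter [1, n]
      rw [← (EuclideanSpace.basisFun (Fin d) ℂ).sum_repr' x, map_sum]
    simp only [P, sum_apply, map_smul]
    exact tendsto_finsetSum _ fun i _ => (hces _).const_smul _
  have hlim : cesaroProj A = P :=
    (tendsto_op_of_tendsto_basis fun i => by rw [hP]; exact hces _).limUnder_eq
  refine tendsto_op_of_tendsto_basis fun i => ?_
  have : ∀ x, ketBra ψ (adjoint (cesaroProj A) ψ) x = c x • ψ := fun x => by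
    rw [ketBra, smulRight_apply, innerSL_apply_apply, adjoint_inner_left, hlim, hP,
      inner_smul_right, inner_self_eq_norm_sq_to_K, hψ]
    simp
  rw [this]
  exact key hTψ hT _

/-- For `A` of class `ℳ_(E)`, the fixed points of `A` are the multiples of `ψ`. -/
lemma mcalE.eq_smul_of_fixed {ψ : Evec d} (hψ : ψ ≠ 0) (hA : mcalE ψ A) {x : Evec d}
    (hx : A x = x) : ∃ c : ℂ, x = c • ψ := by
  have hmem : ∀ {z : Evec d}, A z = z →
      z ∈ Module.End.maxGenEigenspace (A : Evec d →ₗ[ℂ] Evec d) 1 := fun {z} hz => by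
    rw [Module.End.mem_maxGenEigenspace]
    exact ⟨1, by simp [hz]⟩
  obtain ⟨c, hc⟩ := (finrank_eq_one_iff_of_nonzero' (⟨ψ, hmem hA.2.1⟩ :
    Module.End.maxGenEigenspace (A : Evec d →ₗ[ℂ] Evec d) 1) (by simpa using hψ)).1 hA.2.2.2
    ⟨x, hmem hx⟩
  exact ⟨c, (congrArg Subtype.val hc).symm⟩

end Deterministic

section Expectation

/-- A set of positive measure contains a point all of whose neighbourhoods, in the topology induced
by `M`, have positive measure. -/
lemma exists_mem_forall_isOpen_pos {d : ℕ} {Ω : Type*} [MeasurableSpace Ω] {p : Measure Ω}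
    (M : Ω → Op d) {s : Set Ω} (hs : 0 < p s) :
    ∃ ω₀ ∈ s, ∀ U : Set (Op d), IsOpen U → M ω₀ ∈ U → 0 < p (M ⁻¹' U) := by
  let : TopologicalSpace Ω := .induced M inferInstance
  have : SecondCountableTopology Ω := TopologicalSpace.secondCountableTopology_induced _ _ M
  obtain ⟨ω₀, h₀, h⟩ := exists_mem_forall_mem_nhdsWithin_pos_measure hs.ne'
  refine ⟨ω₀, h₀, fun U hU hmem => h _ (mem_nhdsWithin_of_mem_nhds ?_)⟩
  exact (hU.preimage continuous_induced_dom).mem_nhds hmem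

variable {d : ℕ} {Ω : Type*} [MeasurableSpace Ω] {p : Measure Ω} [IsProbabilityMeasure p]
  {M : Ω → Op d} {q : Seminorm ℂ (Evec d)} {ψ : Evec d}

lemma integrable_of_contraction (hM : Measurable M) (hq : ∀ x, q x = 0 → x = 0)
    (hcontr : ∀ ω x, q (M ω x) ≤ q x) : Integrable M p := by
  obtain ⟨K, -, hK⟩ := exists_opNorm_bound q hq
  exact .of_bound hM.aestronglyMeasurable K (.of_forall fun ω => hK _ (hcontr ω))

lemma seminorm_integral_apply_le (hM : Measurable M) (hq : ∀ x, q x = 0 → x = 0)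
    (hcontr : ∀ ω x, q (M ω x) ≤ q x) (x : Evec d) : q ((∫ ω, M ω ∂p) x) ≤ q x := by
  have hint := integrable_of_contraction (p := p) hM hq hcontr
  rw [ContinuousLinearMap.integral_apply hint]
  have hconv : Convex ℝ {y | q y ≤ q x} := by
    simpa using q.convexOn.convex_le (q x)
  exact hconv.integral_mem (isClosed_le q.continuous_evec continuous_const)
    (.of_forall fun ω => hcontr ω x) (hint.apply_continuousLinearMap x)

/-- Functionals vanishing at `ψ` and dominated by the seminorm `q`, as vectors. -/
def annihilatorBall (q : Seminorm ℂ (Evec d)) (ψ : Evec d) : Set (Evec d) :=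
  {v | inner ℂ v ψ = 0 ∧ ∀ y, ‖inner ℂ v y‖ ≤ q y}

lemma isCompact_annihilatorBall (q : Seminorm ℂ (Evec d)) (ψ : Evec d) :
    IsCompact (annihilatorBall q ψ) := by
  obtain ⟨C, hC, h⟩ := q.exists_le_mul_norm
  refine (isCompact_closedBall (0 : Evec d) C).of_isClosed_subset ?_ fun v hv => ?_
  · have hcl : IsClosed (⋂ y, {v : Evec d | ‖(inner ℂ v y : ℂ)‖ ≤ q y}) :=
      isClosed_iInter fun y => isClosed_le (by fun_prop) continuous_const
    have heq : IsClosed {v : Evec d | (inner ℂ v ψ : ℂ) = 0} :=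
      isClosed_eq (by fun_prop) continuous_const
    have hset : annihilatorBall q ψ =
        {v | (inner ℂ v ψ : ℂ) = 0} ∩ ⋂ y, {v : Evec d | ‖(inner ℂ v y : ℂ)‖ ≤ q y} := by
      ext v
      simp [annihilatorBall]
    exact hset ▸ heq.inter hcl
  · have h1 := (hv.2 v).trans (h v)
    rw [inner_self_eq_norm_sq_to_K, norm_pow, RCLike.norm_ofReal, abs_norm] at h1
    rw [mem_closedBall_zero_iff]
    by_contra! hlt
    nlinarith [norm_nonneg v]

lemma adjoint_mem_annihilatorBall {A : Op d} (hA : ∀ x, q (A x) ≤ q x) (hAψ : A ψ = ψ)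
    {v : Evec d} (hv : v ∈ annihilatorBall q ψ) : adjoint A v ∈ annihilatorBall q ψ := by
  refine ⟨?_, fun y => ?_⟩
  · rw [adjoint_inner_left, hAψ, hv.1]
  · rw [adjoint_inner_left]
    exact (hv.2 _).trans (hA y)

lemma exists_mem_annihilatorBall_inner_ne_zero (hq : ∀ x, q x = 0 → x = 0) (hψ : ‖ψ‖ = 1)
    {x : Evec d} (hx : ∀ c : ℂ, x ≠ c • ψ) : ∃ v ∈ annihilatorBall q ψ, inner ℂ v x ≠ 0 := by
  obtain ⟨C, hC, h⟩ := q.exists_norm_le_mul hq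
  set w : Evec d := x - (inner ℂ ψ x : ℂ) • ψ with hw
  have hw0 : w ≠ 0 := sub_ne_zero.2 (hx _)
  have hψψ : inner ℂ ψ ψ = (1 : ℂ) := by simp [inner_self_eq_norm_sq_to_K, hψ]
  have hwψ : inner ℂ w ψ = 0 := by
    rw [hw, inner_sub_left, inner_smul_left, hψψ, inner_conj_symm, mul_one, sub_self]
  have hwx : inner ℂ w x = inner ℂ w w := by
    conv_rhs => rw [hw, inner_sub_right, inner_smul_right, ← hw, hwψ, mul_zero, sub_zero]
  have hε : 0 < (C * ‖w‖)⁻¹ := by positivity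
  refine ⟨(((C * ‖w‖)⁻¹ : ℝ) : ℂ) • w, ⟨?_, fun y => ?_⟩, ?_⟩
  · rw [inner_smul_left, hwψ, mul_zero]
  · rw [inner_smul_left, norm_mul, RCLike.norm_conj, Complex.norm_real,
      Real.norm_of_nonneg hε.le, inv_mul_le_iff₀ (by positivity)]
    calc ‖inner ℂ w y‖ ≤ ‖w‖ * ‖y‖ := norm_inner_le_norm _ _
      _ ≤ ‖w‖ * (C * q y) := by gcongr; exact h y
      _ = _ := by ring
  · rw [inner_smul_left, hwx]
    refine mul_ne_zero ?_ (inner_self_ne_zero.2 hw0)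
    rw [Complex.conj_ofReal]
    exact_mod_cast hε.ne'

/-- The fixed points of the expected operator are the multiples of the common fixed vector. -/
lemma eq_smul_of_integral_fixed (hM : Measurable M) (hq : ∀ x, q x = 0 → x = 0)
    (hcontr : ∀ ω x, q (M ω x) ≤ q x) (hψ : ‖ψ‖ = 1) (hfix : ∀ ω, M ω ψ = ψ)
    (hpos : 0 < p {ω | mcalE ψ (M ω)}) {x : Evec d} (hx : (∫ ω, M ω ∂p) x = x) :
    ∃ c : ℂ, x = c • ψ := by
  by_contra! hne
  obtain ⟨v₀, hv₀, hv₀x⟩ := exists_mem_annihilatorBall_inner_ne_zero hq hψ hne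
  obtain ⟨v, hv, hmax⟩ := (isCompact_annihilatorBall q ψ).exists_isMaxOn ⟨v₀, hv₀⟩
    (f := fun v => ‖inner ℂ v x‖) (by fun_prop)
  have hz : inner ℂ v x ≠ 0 := by
    have h1 : ‖inner ℂ v₀ x‖ ≤ ‖inner ℂ v x‖ := hmax hv₀
    exact norm_pos_iff.1 ((norm_pos_iff.2 hv₀x).trans_le h1)
  have hle : ∀ A : Op d, (∀ y, q (A y) ≤ q y) → A ψ = ψ → ‖inner ℂ v (A x)‖ ≤ ‖inner ℂ v x‖ := by
    intro A hA hAψ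
    rw [← adjoint_inner_left]
    exact hmax (adjoint_mem_annihilatorBall hA hAψ hv)
  obtain ⟨ω₀, hE, hnhds⟩ := exists_mem_forall_isOpen_pos M hpos
  have hint := integrable_of_contraction (p := p) hM hq hcontr
  have hpow : ∀ k : ℕ, (M ω₀ ^ k) ψ = ψ := fun k => by
    induction k with
    | zero => simp
    | succ k ih => rw [pow_succ']; exact (congrArg _ ih).trans (hfix ω₀)
  have hconst : ∀ k : ℕ, inner ℂ v ((M ω₀ ^ k) x) = inner ℂ v x := by
    intro k
    induction k with
    | zero => simp
    | succ k ih =>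
      let φ : Op d →L[ℂ] ℂ := (innerSL ℂ v).comp ((M ω₀ ^ k).comp
        (ContinuousLinearMap.apply ℂ (Evec d) x))
      have hφ : ∀ A, φ A = inner ℂ v ((M ω₀ ^ k) (A x)) := fun A => rfl
      have hφint : ∫ ω, φ (M ω) ∂p = inner ℂ v x := by
        rw [φ.integral_comp_comm hint, hφ, hx, ih]
      have hφle : ∀ ω, ‖φ (M ω)‖ ≤ ‖inner ℂ v x‖ := fun ω =>
        hle (M ω₀ ^ k * M ω)
          (fun y => (seminorm_pow_apply_le (hcontr ω₀) k _).trans (hcontr ω y))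
          ((congrArg _ (hfix ω)).trans (hpow k))
      have hae : ∀ᵐ ω ∂p, φ (M ω) = inner ℂ v x := by
        rcases ae_eq_const_or_norm_integral_lt_of_norm_le_const (μ := p) (.of_forall hφle) with h | h
        · rw [average_eq_integral, hφint] at h
          exact h
        · rw [hφint] at h
          simp at h
      by_contra hcon
      have := hnhds {A | φ A ≠ inner ℂ v x} (isOpen_ne_fun φ.continuous continuous_const) (by
        rw [pow_succ] at hcon
        exact hcon)
      exact this.ne' (ae_iff.1 hae)
  obtain ⟨u, y, hu, hxu⟩ := exists_fixed_add_range hq (hcontr ω₀) x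
  obtain ⟨c, rfl⟩ := hE.eq_smul_of_fixed (by rintro rfl; simp at hψ) hu
  have h1 : Tendsto (fun N => inner ℂ v (cesaroAvg (M ω₀) N x)) atTop
      (𝓝 (inner ℂ v (c • ψ + 0))) := by
    have h2 := tendsto_op_apply (tendsto_cesaroAvg_mul_sub hq (hcontr ω₀)) y
    refine Tendsto.inner tendsto_const_nhds ((tendsto_const_nhds.add h2).congr' ?_)
    filter_upwards [eventually_ne_atTop 0] with N hN
    conv_rhs => rw [hxu, map_add, cesaroAvg_apply_of_fixed hu hN]
    simp
  have h3 : Tendsto (fun N => inner ℂ v (cesaroAvg (M ω₀) N x)) atTop (𝓝 (inner ℂ v x)) := by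
    refine tendsto_const_nhds.congr' ?_
    filter_upwards [eventually_ne_atTop 0] with N hN
    rw [cesaroAvg, smul_apply, sum_apply, inner_smul_right, inner_sum]
    simp_rw [hconst]
    simp [hN]
  refine hz ((tendsto_nhds_unique h3 h1).trans ?_)
  rw [add_zero, inner_smul_right, hv.1, mul_zero]

end Expectation

section LargeNumbers

variable {Ω : Type*} [MeasurableSpace Ω] {μ : Measure Ω} [IsProbabilityMeasure μ]
  {E : Type*} [NormedAddCommGroup E] [InnerProductSpace ℂ E]

lemma integral_norm_sq_sum_le {z : ℕ → Ω → E} (hz : ∀ n, AEStronglyMeasurable (z n) μ) {C : ℝ}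
    (hC : ∀ n ω, ‖z n ω‖ ≤ C) {L : ℕ}
    (horth : ∀ m n, m + L ≤ n → ∫ ω, inner ℂ (z m ω) (z n ω) ∂μ = 0) (n : ℕ) :
    ∫ ω, ‖∑ k ∈ Finset.range n, z k ω‖ ^ 2 ∂μ ≤ n * (2 * L * C ^ 2) := by
  have hC0 : 0 ≤ C := by
    obtain ⟨ω⟩ := μ.nonempty_of_neZero
    exact (norm_nonneg _).trans (hC 0 ω)
  have hbound : ∀ m k ω, ‖(inner ℂ (z m ω) (z k ω) : ℂ)‖ ≤ C ^ 2 := fun m k ω => by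
    rw [sq]
    exact (norm_inner_le_norm _ _).trans
      (mul_le_mul (hC m ω) (hC k ω) (norm_nonneg _) hC0)
  have hint : ∀ m k, Integrable (fun ω => (inner ℂ (z m ω) (z k ω) : ℂ)) μ := fun m k =>
    .of_bound ((hz m).inner (hz k)) (C ^ 2) (.of_forall (hbound m k))
  have hzero : ∀ m k, m + L ≤ k ∨ k + L ≤ m → ∫ ω, (inner ℂ (z m ω) (z k ω) : ℂ) ∂μ = 0 := by
    rintro m k (h | h)
    · exact horth m k h
    · have h1 := horth k m h
      calc ∫ ω, (inner ℂ (z m ω) (z k ω) : ℂ) ∂μ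
          = ∫ ω, (starRingEnd ℂ) (inner ℂ (z k ω) (z m ω)) ∂μ := by simp_rw [inner_conj_symm]
        _ = 0 := by rw [integral_conj, h1, map_zero]
  have hre : ∀ m k, (∫ ω, (inner ℂ (z m ω) (z k ω) : ℂ) ∂μ).re ≤
      if k ∈ Finset.Ico (m + 1 - L) (m + L) then C ^ 2 else 0 := by
    intro m k
    split_ifs with h
    · refine (Complex.re_le_norm _).trans ?_
      simpa using norm_integral_le_of_norm_le_const (μ := μ) (.of_forall (hbound m k))
    · rw [hzero m k (by simp only [Finset.mem_Ico] at h; omega), Complex.zero_re]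
  have hexp : ∀ ω, ‖∑ k ∈ Finset.range n, z k ω‖ ^ 2 =
      (∑ m ∈ Finset.range n, ∑ k ∈ Finset.range n, (inner ℂ (z m ω) (z k ω) : ℂ)).re := fun ω => by
    rw [← inner_self_eq_norm_sq (𝕜 := ℂ), sum_inner]
    simp_rw [inner_sum]
    rfl
  have hexp' : ∫ ω, ‖∑ k ∈ Finset.range n, z k ω‖ ^ 2 ∂μ =
      ∑ m ∈ Finset.range n, ∑ k ∈ Finset.range n,
        (∫ ω, (inner ℂ (z m ω) (z k ω) : ℂ) ∂μ).re := by
    simp_rw [hexp]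
    have hi := fun m (_ : m ∈ Finset.range n) =>
      integrable_finsetSum (Finset.range n) fun k _ => hint m k
    rw [← RCLike.re_eq_complex_re, integral_re (integrable_finsetSum _ hi),
      integral_finsetSum _ hi, map_sum]
    refine Finset.sum_congr rfl fun m _ => ?_
    rw [integral_finsetSum _ fun k _ => hint m k, map_sum]
  rw [hexp']
  calc _ ≤ ∑ m ∈ Finset.range n, 2 * L * C ^ 2 := by
        refine Finset.sum_le_sum fun m _ => ?_
        calc _ ≤ ∑ k ∈ Finset.range n,
              if k ∈ Finset.Ico (m + 1 - L) (m + L) then C ^ 2 else 0 :=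
              Finset.sum_le_sum fun k _ => hre m k
          _ = ((Finset.range n).filter (· ∈ Finset.Ico (m + 1 - L) (m + L))).card * C ^ 2 := by
              rw [← Finset.sum_filter, Finset.sum_const, nsmul_eq_mul]
          _ ≤ (2 * L : ℕ) * C ^ 2 := by
              gcongr
              calc _ ≤ (Finset.Ico (m + 1 - L) (m + L)).card :=
                    Finset.card_le_card fun k hk => (Finset.mem_filter.1 hk).2
                _ ≤ 2 * L := by rw [Nat.card_Ico]; omega
          _ = _ := by push_cast; ring
    _ = _ := by rw [Finset.sum_const, Finset.card_range, nsmul_eq_mul]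

/-- If the averages along the squares tend to zero, so do all averages of a bounded sequence. -/
lemma tendsto_average_of_squares {z : ℕ → E} {C : ℝ} (hC : ∀ n, ‖z n‖ ≤ C)
    (h : Tendsto (fun k : ℕ => ‖∑ i ∈ Finset.range (k ^ 2), z i‖ / (k : ℝ) ^ 2) atTop (𝓝 0)) :
    Tendsto (fun n : ℕ => (n : ℝ)⁻¹ • ∑ i ∈ Finset.range n, z i) atTop (𝓝 0) := by
  have hC0 : 0 ≤ C := (norm_nonneg _).trans (hC 0)
  have hsqrt : Tendsto Nat.sqrt atTop atTop :=
    tendsto_atTop_atTop.2 fun b => ⟨b ^ 2, fun n hn => by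
      rw [Nat.le_sqrt']; exact hn⟩
  have hlim : Tendsto (fun k : ℕ => ‖∑ i ∈ Finset.range (k ^ 2), z i‖ / (k : ℝ) ^ 2 + 2 * C / k)
      atTop (𝓝 0) := by
    simpa using h.add (tendsto_const_div_atTop_nhds_zero_nat (2 * C))
  rw [tendsto_zero_iff_norm_tendsto_zero]
  refine squeeze_zero' (.of_forall fun n => norm_nonneg _) ?_ (hlim.comp hsqrt)
  filter_upwards [eventually_gt_atTop 0] with n hn
  set k := Nat.sqrt n with hk
  have hk0 : 0 < k := Nat.sqrt_pos.2 hn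
  have hkn : k ^ 2 ≤ n := Nat.sqrt_le' n
  have hnk : n ≤ k ^ 2 + 2 * k := by
    have := Nat.sqrt_le_add n
    rw [← hk] at this
    nlinarith
  have hsum : ‖∑ i ∈ Finset.range n, z i‖ ≤ ‖∑ i ∈ Finset.range (k ^ 2), z i‖ + 2 * k * C := by
    rw [← Finset.sum_range_add_sum_Ico _ hkn]
    refine (norm_add_le _ _).trans (by
      gcongr
      calc _ ≤ ∑ i ∈ Finset.Ico (k ^ 2) n, C := norm_sum_le_of_le _ fun i _ => hC i
        _ = ((n - k ^ 2 : ℕ) : ℝ) * C := by simp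
        _ ≤ ((2 * k : ℕ) : ℝ) * C := by gcongr; omega
        _ = _ := by push_cast; ring)
  have hkR : (0 : ℝ) < k := by exact_mod_cast hk0
  have hknR : (k : ℝ) ^ 2 ≤ n := by exact_mod_cast hkn
  rw [norm_smul, norm_inv, Real.norm_natCast, inv_mul_eq_div]
  calc _ ≤ (‖∑ i ∈ Finset.range (k ^ 2), z i‖ + 2 * k * C) / (k : ℝ) ^ 2 := by gcongr
    _ = _ := by simp only [Function.comp, ← hk]; field_simp

/-- Strong law of large numbers for bounded sequences whose terms at distance at least `L` are
orthogonal. -/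
lemma ae_tendsto_average_of_orthogonal {z : ℕ → Ω → E} (hz : ∀ n, AEStronglyMeasurable (z n) μ)
    {C : ℝ} (hC : ∀ n ω, ‖z n ω‖ ≤ C) {L : ℕ}
    (horth : ∀ m n, m + L ≤ n → ∫ ω, inner ℂ (z m ω) (z n ω) ∂μ = 0) :
    ∀ᵐ ω ∂μ, Tendsto (fun n : ℕ => (n : ℝ)⁻¹ • ∑ i ∈ Finset.range n, z i ω) atTop (𝓝 0) := by
  let S : ℕ → Ω → E := fun n ω => ∑ i ∈ Finset.range n, z i ω
  have hSm : ∀ n, AEStronglyMeasurable (S n) μ := fun n =>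
    Finset.aestronglyMeasurable_fun_sum _ fun i _ => hz i
  have hSb : ∀ n ω, ‖S n ω‖ ≤ n * C := fun n ω => by
    calc _ ≤ ∑ i ∈ Finset.range n, C := norm_sum_le_of_le _ fun i _ => hC i ω
      _ = _ := by simp
  let f : ℕ → Ω → ℝ := fun k ω => (‖S (k ^ 2) ω‖ / (k : ℝ) ^ 2) ^ 2
  have hfm : ∀ k, AEStronglyMeasurable (f k) μ := fun k =>
    ((hSm _).norm.mul aestronglyMeasurable_const).pow 2
  have hfint : ∀ k, Integrable (f k) μ := fun k => by
    refine .of_bound (hfm k) ((((k ^ 2 : ℕ) : ℝ) * C / (k : ℝ) ^ 2) ^ 2) (.of_forall fun ω => ?_)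
    rw [Real.norm_of_nonneg (sq_nonneg _)]
    gcongr
    exact hSb _ ω
  have hfle : ∀ k, ∫ ω, f k ω ∂μ ≤ 2 * L * C ^ 2 * (1 / (k : ℝ) ^ 2) := fun k => by
    have h1 := integral_norm_sq_sum_le hz hC horth (k ^ 2)
    simp only [f, div_pow]
    rw [integral_div]
    rcases Nat.eq_zero_or_pos k with rfl | hk
    · simp
    have hkR : (0 : ℝ) < k := by exact_mod_cast hk
    rw [div_le_iff₀ (by positivity)]
    refine h1.trans (le_of_eq ?_)
    push_cast
    field_simp
  have hsummable : ∑' k, ∫⁻ ω, ENNReal.ofReal (f k ω) ∂μ ≠ ⊤ := by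
    have hs : Summable fun k : ℕ => 2 * L * C ^ 2 * (1 / (k : ℝ) ^ 2) :=
      (Real.summable_one_div_nat_pow.2 one_lt_two).mul_left _
    refine ne_top_of_le_ne_top hs.tsum_ofReal_ne_top (ENNReal.tsum_le_tsum fun k => ?_)
    rw [← ofReal_integral_eq_lintegral_ofReal (hfint k) (.of_forall fun ω => by positivity)]
    exact ENNReal.ofReal_le_ofReal (hfle k)
  rw [← lintegral_tsum fun k => (hfm k).aemeasurable.ennreal_ofReal] at hsummable
  filter_upwards [ae_lt_top' (AEMeasurable.tsum
    fun k => (hfm k).aemeasurable.ennreal_ofReal) hsummable] with ω hω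
  refine tendsto_average_of_squares (fun n => hC n ω) ?_
  have h0 : Tendsto (fun k => f k ω) atTop (𝓝 0) := by
    have h1 := (ENNReal.tendsto_toReal ENNReal.zero_ne_top).comp
      (ENNReal.tendsto_atTop_zero_of_tsum_ne_top hω.ne)
    refine h1.congr fun k => ?_
    exact ENNReal.toReal_ofReal (by positivity)
  have h2 := h0.sqrt
  rw [Real.sqrt_zero] at h2
  exact h2.congr fun k => Real.sqrt_sq (by positivity)

end LargeNumbers

section ProductSpace

variable {Ω : Type*} [MeasurableSpace Ω] {p : Measure Ω} [IsProbabilityMeasure p]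

/-- A probability measure on sequences with the marginals of the product measure is the product
measure. -/
lemma eq_infinitePi_of_map_fin {P : Measure (ℕ → Ω)}
    (hP : ∀ n : ℕ, P.map (fun ω (i : Fin n) => ω i) = Measure.pi fun _ : Fin n => p) :
    P = Measure.infinitePi fun _ => p := by
  classical
  refine Measure.eq_infinitePi _ fun s t ht => ?_
  obtain ⟨n, hn⟩ : ∃ n, s ⊆ Finset.range n := s.exists_nat_subset_range
  let t' : ℕ → Set Ω := fun i => if i ∈ s then t i else Set.univ
  have ht' : ∀ i, MeasurableSet (t' i) := fun i => by
    simp only [t']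
    split_ifs
    exacts [ht i, .univ]
  have hset : Set.pi s t =
      (fun (ω : ℕ → Ω) (i : Fin n) => ω i) ⁻¹' Set.univ.pi fun i : Fin n => t' i := by
    ext ω
    simp only [Set.mem_pi, Set.mem_preimage, Finset.mem_coe, Set.mem_univ, true_imp_iff, t']
    constructor
    · intro h i
      split_ifs with hi
      exacts [h i hi, Set.mem_univ _]
    · intro h i hi
      have := h ⟨i, Finset.mem_range.1 (hn hi)⟩
      rwa [if_pos hi] at this
  have hmeas : Measurable fun (ω : ℕ → Ω) (i : Fin n) => ω i :=
    measurable_pi_lambda _ fun i => measurable_pi_apply _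
  have hbox : MeasurableSet (Set.univ.pi fun i : Fin n => t' i) := .univ_pi fun i => ht' i
  rw [hset, ← Measure.map_apply hmeas hbox, hP, Measure.pi_pi,
    Fin.prod_univ_eq_prod_range (fun i => p (t' i)) n, ← Finset.prod_subset hn]
  · exact Finset.prod_congr rfl fun i hi => by simp [t', hi]
  · intro i _ hi
    simp [t', hi]

lemma iIndepFun_coordinates :
    iIndepFun (fun (i : ℕ) (ω : ℕ → Ω) => ω i) (Measure.infinitePi fun _ => p) :=
  iIndepFun_infinitePi (P := fun _ : ℕ => p) (X := fun _ ω => ω) fun _ => measurable_id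

lemma infinitePi_map_window (n L : ℕ) :
    (Measure.infinitePi fun _ : ℕ => p).map (fun ω (i : Fin L) => ω (n + i)) =
      Measure.pi fun _ : Fin L => p := by
  have hinj : Function.Injective fun i : Fin L => n + (i : ℕ) := fun i j h =>
    Fin.ext (Nat.add_left_cancel h)
  rw [(iIndepFun_iff_map_fun_eq_pi_map (fun i : Fin L => (measurable_pi_apply _).aemeasurable)).1
    (iIndepFun_coordinates.precomp hinj)]
  simp_rw [Measure.infinitePi_map_eval (fun _ : ℕ => p)]

lemma indepFun_past_window (n L : ℕ) :
    IndepFun (fun (ω : ℕ → Ω) (i : Finset.range n) => ω i) (fun ω (i : Fin L) => ω (n + i))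
      (Measure.infinitePi fun _ => p) := by
  have h := iIndepFun_coordinates (p := p).indepFun_finset (Finset.range n)
    (Finset.Ico n (n + L)) (by
      rw [Finset.disjoint_left]
      intro i hi hi'
      simp only [Finset.mem_range, Finset.mem_Ico] at hi hi'
      omega) (fun i => measurable_pi_apply i)
  exact h.comp (φ := id)
    (ψ := fun (x : Finset.Ico n (n + L) → Ω) (i : Fin L) => x ⟨n + i, by simp⟩)
    measurable_id (by fun_prop)

variable {d : ℕ}

/-- A centred function of a window is orthogonal to every bounded function of its past. -/
lemma integral_inner_past_window_eq_zero {n L : ℕ} {g : (ℕ → Ω) → Evec d} (hg : Measurable g)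
    (hdep : DependsOn g (Set.Iio n)) {C : ℝ} (hC : ∀ ω, ‖g ω‖ ≤ C) {w : (Fin L → Ω) → Evec d}
    (hw : Integrable w (Measure.pi fun _ => p)) (hw0 : ∫ x, w x ∂(Measure.pi fun _ => p) = 0) :
    ∫ ω, (inner ℂ (g ω) (w fun i : Fin L => ω (n + i)) : ℂ) ∂(Measure.infinitePi fun _ => p) =
      0 := by
  obtain ⟨ω₀⟩ := p.nonempty_of_neZero
  let ext : (Finset.range n → Ω) → ℕ → Ω := fun x i =>
    if h : i ∈ Finset.range n then x ⟨i, h⟩ else ω₀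
  have hext : Measurable ext := measurable_pi_lambda _ fun i => by
    by_cases h : i ∈ Finset.range n
    · simp only [ext, h, dite_true]
      fun_prop
    · simp only [ext, h, dite_false]
      fun_prop
  have hgext : ∀ ω : ℕ → Ω, g (ext fun i => ω i) = g ω := fun ω => hdep fun i hi => by
    simp [ext, Set.mem_Iio.1 hi]
  have hwin : Measurable fun (ω : ℕ → Ω) (i : Fin L) => ω (n + i) := by fun_prop
  have key := (indepFun_past_window (p := p) n L).integral_bilin_comp_comp
    (f := fun x => innerSL ℂ (g (ext x))) (g := w) (𝕜 := ℂ)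
    (measurable_pi_lambda _ fun i => measurable_pi_apply _).aemeasurable hwin.aemeasurable
    (.of_bound ((innerSL ℂ).continuous.measurable.comp (hg.comp hext)).aestronglyMeasurable C
      (.of_forall fun x => by simpa using hC _))
    (by rwa [infinitePi_map_window])
    (ContinuousLinearMap.id ℂ (Evec d →L[ℂ] ℂ))
  have hw' : ∫ ω, w (fun i : Fin L => ω (n + i)) ∂(Measure.infinitePi fun _ => p) = 0 := by
    rw [← hw0, ← infinitePi_map_window (p := p) n L,
      integral_map hwin.aemeasurable (by rw [infinitePi_map_window]; exact hw.1)]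
  rw [hw', map_zero] at key
  simpa [hgext] using key

end ProductSpace

section RandomProducts

variable {d : ℕ} {Ω : Type*}

lemma real_smul_mul (c : ℝ) (A B : Op d) : (c • A) * B = c • (A * B) :=
  ContinuousLinearMap.ext fun _ => rfl

/-- The product `M(ω_1) ⋯ M(ω_n)`. -/
def prodOp (M : Ω → Op d) (n : ℕ) (ω : ℕ → Ω) : Op d :=
  (List.ofFn fun i : Fin n => M (ω i)).prod

variable {M : Ω → Op d}

lemma prodOp_succ (n : ℕ) (ω : ℕ → Ω) : prodOp M (n + 1) ω = prodOp M n ω * M (ω n) := by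
  simp only [prodOp, List.ofFn_succ', List.prod_concat, Fin.val_castSucc, Fin.val_last]

lemma prodOp_apply_of_fixed {ψ : Evec d} (hfix : ∀ ω, M ω ψ = ψ) (n : ℕ) (ω : ℕ → Ω) :
    prodOp M n ω ψ = ψ := by
  induction n with
  | zero => simp [prodOp]
  | succ n ih => rw [prodOp_succ, mul_apply_eq_comp, hfix, ih]

lemma seminorm_prodOp_apply_le {q : Seminorm ℂ (Evec d)} (hcontr : ∀ ω x, q (M ω x) ≤ q x)
    (n : ℕ) (ω : ℕ → Ω) (x : Evec d) : q (prodOp M n ω x) ≤ q x := by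
  induction n generalizing x with
  | zero => simp [prodOp]
  | succ n ih => rw [prodOp_succ, mul_apply_eq_comp]; exact (ih _).trans (hcontr _ _)

lemma dependsOn_prodOp (n : ℕ) : DependsOn (prodOp M n) (Set.Iio n) := fun ω ω' h => by
  simp only [prodOp]
  congr 2
  ext1 i
  rw [h i i.2]

variable [MeasurableSpace Ω]

lemma measurable_prodOp (hM : Measurable M) (n : ℕ) : Measurable (prodOp M n) := by
  induction n with
  | zero => exact measurable_const
  | succ n ih =>
    simp_rw [funext (prodOp_succ (M := M) n)]
    exact continuous_mul.measurable.comp (ih.prodMk (hM.comp (measurable_pi_apply n)))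

variable {p : Measure Ω} [IsProbabilityMeasure p]

/-- Averages of random products times a centred function of the window that follows vanish. -/
lemma ae_tendsto_average_prodOp_mul {q : Seminorm ℂ (Evec d)} (hM : Measurable M)
    (hq : ∀ x, q x = 0 → x = 0) (hcontr : ∀ ω x, q (M ω x) ≤ q x) {L : ℕ}
    {N : (Fin L → Ω) → Op d} (hN : Measurable N) {B : ℝ} (hB : ∀ x, ‖N x‖ ≤ B) :
    ∀ᵐ ω ∂(Measure.infinitePi fun _ : ℕ => p),
      Tendsto (fun ν : ℕ => (ν : ℝ)⁻¹ • ∑ n ∈ Finset.range ν, prodOp M (n + 1) ω *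
        (N (fun i : Fin L => ω (n + 1 + i)) - ∫ x, N x ∂(Measure.pi fun _ => p)))
        atTop (𝓝 0) := by
  obtain ⟨K, hK0, hK⟩ := exists_opNorm_bound q hq
  have hY : ∀ n ω, ‖prodOp M n ω‖ ≤ K := fun n ω => hK _ (seminorm_prodOp_apply_le hcontr n ω)
  have hNint : Integrable N (Measure.pi fun _ => p) :=
    .of_bound hN.aestronglyMeasurable B (.of_forall hB)
  set EN := ∫ x, N x ∂(Measure.pi fun _ => p) with hEN
  have hbasis : ∀ e : Evec d, ∀ᵐ ω ∂(Measure.infinitePi fun _ : ℕ => p),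
      Tendsto (fun ν : ℕ => (ν : ℝ)⁻¹ • ∑ n ∈ Finset.range ν,
        prodOp M (n + 1) ω ((N (fun i : Fin L => ω (n + 1 + i)) - EN) e)) atTop (𝓝 0) := by
    intro e
    let w : (Fin L → Ω) → Evec d := fun x => (N x - EN) e
    have hw : Measurable w :=
      (ContinuousLinearMap.apply ℂ (Evec d) e).continuous.measurable.comp (hN.sub_const EN)
    have hwint : Integrable w (Measure.pi fun _ => p) :=
      (hNint.sub (integrable_const EN)).apply_continuousLinearMap e
    have hw0 : ∫ x, w x ∂(Measure.pi fun _ => p) = 0 := by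
      have h := ContinuousLinearMap.integral_apply (hNint.sub (integrable_const EN)) e
      simp only [Pi.sub_apply] at h
      rw [← h, integral_sub hNint (integrable_const EN)]
      simp [hEN]
    have hwb : ∀ x, ‖w x‖ ≤ (B + ‖EN‖) * ‖e‖ := fun x =>
      (le_opNorm _ _).trans (by gcongr; exact (norm_sub_le _ _).trans (by gcongr; exact hB x))
    let z : ℕ → (ℕ → Ω) → Evec d := fun n ω =>
      prodOp M (n + 1) ω (w fun i : Fin L => ω (n + 1 + i))
    have happly : Measurable fun a : Op d × Evec d => a.1 a.2 := by
      exact (isBoundedBilinearMap_apply (𝕜 := ℂ) (E := Evec d) (F := Evec d)).continuous.measurable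
    have hz : ∀ n, Measurable (z n) := fun n =>
      happly.comp ((measurable_prodOp hM _).prodMk (hw.comp (by fun_prop)))
    have hzb : ∀ n ω, ‖z n ω‖ ≤ K * ((B + ‖EN‖) * ‖e‖) := fun n ω =>
      (le_opNorm _ _).trans (by gcongr; exacts [hY _ _, hwb _])
    refine ae_tendsto_average_of_orthogonal (L := L + 1) (z := z)
      (fun n => (hz n).aestronglyMeasurable) hzb fun m n hmn => ?_
    let g : (ℕ → Ω) → Evec d := fun ω => adjoint (prodOp M (n + 1) ω) (z m ω)
    have hg : Measurable g := happly.comp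
      (((adjoint (𝕜 := ℂ) (E := Evec d) (F := Evec d)).continuous.measurable.comp
        (measurable_prodOp hM _)).prodMk (hz m))
    have hdep : DependsOn g (Set.Iio (n + 1)) := fun ω ω' h => by
      have h₁ : prodOp M (n + 1) ω = prodOp M (n + 1) ω' := dependsOn_prodOp _ h
      have h₂ : prodOp M (m + 1) ω = prodOp M (m + 1) ω' :=
        dependsOn_prodOp _ fun i hi => h i (by simp only [Set.mem_Iio] at hi ⊢; omega)
      have h₃ : (fun i : Fin L => ω (m + 1 + i)) = fun i : Fin L => ω' (m + 1 + i) :=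
        funext fun i => h _ (by simp only [Set.mem_Iio]; omega)
      simp only [g, z, h₁, h₂, h₃]
    have hgb : ∀ ω, ‖g ω‖ ≤ K * (K * ((B + ‖EN‖) * ‖e‖)) := fun ω =>
      (le_opNorm _ _).trans (by
        gcongr
        exacts [(adjoint.norm_map _).trans_le (hY _ _), hzb _ _])
    rw [← integral_inner_past_window_eq_zero hg hdep hgb hwint hw0]
    simp only [g, z, adjoint_inner_left]
  filter_upwards [ae_all_iff.2 fun i => hbasis (EuclideanSpace.basisFun (Fin d) ℂ i)] with ω hω
  refine tendsto_op_of_tendsto_basis fun i => ?_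
  simpa [sum_apply] using hω i

/-- The averages of the random products converge almost surely. -/
lemma ae_tendsto_average_prodOp {q : Seminorm ℂ (Evec d)} (hM : Measurable M)
    (hq : ∀ x, q x = 0 → x = 0) (hcontr : ∀ ω x, q (M ω x) ≤ q x) {ψ : Evec d}
    (hψ : ‖ψ‖ = 1) (hfix : ∀ ω, M ω ψ = ψ) (hpos : 0 < p {ω | mcalE ψ (M ω)}) :
    ∀ᵐ ω ∂(Measure.infinitePi fun _ : ℕ => p),
      Tendsto (fun ν : ℕ => (ν : ℝ)⁻¹ • ∑ n ∈ Finset.range ν, prodOp M (n + 1) ω)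
        atTop (𝓝 (ketBra ψ (adjoint (cesaroProj (∫ ω, M ω ∂p)) ψ))) := by
  obtain ⟨K, hK0, hK⟩ := exists_opNorm_bound q hq
  have hY : ∀ n ω, ‖prodOp M n ω‖ ≤ K := fun n ω => hK _ (seminorm_prodOp_apply_le hcontr n ω)
  have hint := integrable_of_contraction (p := p) hM hq hcontr
  set E := ∫ ω, M ω ∂p with hE
  have hEψ : E ψ = ψ := by
    rw [hE, ContinuousLinearMap.integral_apply hint]
    simp [hfix]
  have hEM : ∫ x : Fin 1 → Ω, M (x 0) ∂(Measure.pi fun _ => p) = E := by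
    have h := measurePreserving_eval (fun _ : Fin 1 => p) 0
    have h' := integral_map h.aemeasurable (f := M) (by rw [h.map_eq]; exact hint.1)
    rw [h.map_eq] at h'
    exact h'.symm
  have hlim := ae_tendsto_average_prodOp_mul (p := p) hM hq hcontr (L := 1)
    (N := fun x => M (x 0)) (hM.comp (measurable_pi_apply 0)) (fun x => hK _ (hcontr _))
  rw [hEM] at hlim
  filter_upwards [hlim] with ω hω
  refine tendsto_of_simple hq (seminorm_integral_apply_le hM hq hcontr) hψ hEψ
    (fun x => eq_smul_of_integral_fixed hM hq hcontr hψ hfix hpos) ?_ ?_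
  · filter_upwards [eventually_ne_atTop 0] with ν hν
    have hν' : (ν : ℝ) ≠ 0 := Nat.cast_ne_zero.2 hν
    simp [sum_apply, prodOp_apply_of_fixed hfix, ← Nat.cast_smul_eq_nsmul ℝ, smul_smul, hν']
  · have htel : ∀ ν : ℕ, (∑ n ∈ Finset.range ν, prodOp M (n + 1) ω) * (1 - E) =
        (prodOp M 1 ω - prodOp M (ν + 1) ω) +
          ∑ n ∈ Finset.range ν, prodOp M (n + 1) ω * (M (ω (n + 1)) - E) := fun ν => by
      induction ν with
      | zero => simp
      | succ ν ih =>
        rw [Finset.sum_range_succ, Finset.sum_range_succ, add_mul, ih, prodOp_succ (ν + 1)]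
        noncomm_ring
    have hbdd := tendsto_inv_smul_of_bounded (𝕜 := ℝ) (C := K + K)
      (u := fun ν => prodOp M 1 ω - prodOp M (ν + 1) ω)
      fun ν => (norm_sub_le _ _).trans (add_le_add (hY _ _) (hY _ _))
    rw [← hE]
    simp_rw [real_smul_mul, htel, smul_add]
    simpa using hbdd.add hω

end RandomProducts

/-- Ergodic limit of infinite operator product: for a bounded measurable
`N : Ω^{l+r+1} → M_d(ℂ)`, almost surely
`(1/ν) Σ_{n=1}^ν M(ω_1)⋯M(ω_n) N(ω_{n+1},…,ω_{n+l+r+1}) → |ψ_S⟩⟨θ| E[N]`, with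
`θ = P_{1,E[M]}^* ψ_S`.  Here `ω̄ = (ω̄ 0, ω̄ 1, …)` stands for `(ω_1, ω_2, …)`. -/
theorem stmt16 {d : ℕ} (hd : 1 ≤ d) {Ω : Type*} [MeasurableSpace Ω]
    (p : Measure Ω) [IsProbabilityMeasure p]
    (M : Ω → Op d) (hMmeas : Measurable M)
    (Nrm : Seminorm ℂ (Evec d)) (hNrm : ∀ x, Nrm x = 0 → x = 0)
    (hcontr : ∀ (ω : Ω) (x : Evec d), Nrm (M ω x) ≤ Nrm x)
    (ψS : Evec d) (hψS : ‖ψS‖ = 1) (hfix : ∀ ω, M ω ψS = ψS)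
    (Pb : Measure (ℕ → Ω)) [IsProbabilityMeasure Pb]
    (hPb : ∀ n : ℕ, Pb.map (fun ωb (i : Fin n) => ωb i) = Measure.pi fun _ : Fin n => p)
    (hpos : 0 < p {ω | mcalE ψS (M ω)})
    (l r : ℕ) (Nf : (Fin (l + r + 1) → Ω) → Op d)
    (hNmeas : Measurable Nf) (hNbd : ∃ B : ℝ, ∀ x, ‖Nf x‖ ≤ B) :
    ∃ Ω₅ : Set (ℕ → Ω), Pb Ω₅ = 1 ∧
      ∀ ωb ∈ Ω₅,
        Tendsto
          (fun ν : ℕ => (ν : ℝ)⁻¹ •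
            ∑ n ∈ Finset.range ν,
              ((List.ofFn fun i : Fin (n + 1) => M (ωb i)).prod) *
                Nf (fun i : Fin (l + r + 1) => ωb (n + 1 + i)))
          atTop
          (nhds (ketBra ψS (adjoint (cesaroProj (∫ ω, M ω ∂p)) ψS) *
            ∫ x, Nf x ∂(Measure.pi fun _ : Fin (l + r + 1) => p))) := by
  have h₁ := ae_tendsto_average_prodOp (p := p) hMmeas hNrm hcontr hψS hfix hpos
  obtain ⟨B, hB⟩ := hNbd
  have h₂ := ae_tendsto_average_prodOp_mul (p := p) hMmeas hNrm hcontr hNmeas hB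
  rw [← eq_infinitePi_of_map_fin hPb] at h₁ h₂
  refine ⟨{ωb | _}, ?_, fun ωb hωb => hωb⟩
  refine (measure_congr (eventuallyEq_univ.2 ?_)).trans measure_univ
  filter_upwards [h₁, h₂] with ωb hω₁ hω₂
  have h := hω₂.add (hω₁.mul_const (∫ x, Nf x ∂(Measure.pi fun _ : Fin (l + r + 1) => p)))
  rw [zero_add] at h
  refine h.congr fun ν => ?_
  rw [real_smul_mul]
  refine (smul_add _ _ _).symm.trans (congrArg _ ?_)
  rw [Finset.sum_mul, ← Finset.sum_add_distrib]
  simp_rw [← mul_add, sub_add_cancel]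
  rfl
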